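/- Let d > 0 and L := d/√2. There exists α₁ > 0 such that for every α with 0 ≤ α < α₁ there is a nonzero test function φ satisfying ∫_Ω ‖∇φ(x,y)‖² d(x,y) + α·∫₀^∞ |φ(x,x)|² dx < k_D(α)²·∫_Ω |φ(x,y)|² d(x,y). (This is the variational form of the statement that the discrete spectrum of H_α is non-empty for all sufficiently small coupling strengths α.) -/

import Mathlib

open Real Set MeasureTheory

/-- The configuration domain `Ω = {(x,y) : x ≥ 0, y ≥ 0, |x - y| ≤ d}`. -/
def pairDomain (d : ℝ) : Set (ℝ × ℝ) :=
  {p : ℝ × ℝ | 0 ≤ p.1 ∧ 0 ≤ p.2 ∧ |p.1 - p.2| ≤ d}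

/-- A test function: `C¹`, compactly supported, symmetric, vanishing on
`∂Ω_D = {(x,y) ∈ Ω : |x - y| = d}`. -/
def IsTestFunction (d : ℝ) (φ : ℝ × ℝ → ℝ) : Prop :=
  ContDiff ℝ 1 φ ∧ HasCompactSupport φ ∧
  (∀ x y : ℝ, φ (x, y) = φ (y, x)) ∧
  (∀ p : ℝ × ℝ, 0 ≤ p.1 → 0 ≤ p.2 → |p.1 - p.2| = d → φ p = 0)

/-- A smooth strict upper bound for the absolute value. -/
noncomputable def softAbs (z : ℝ) : ℝ := √(z ^ 2 + (1 / 200) ^ 2)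

/-- A smooth symmetric upper bound for the maximum of two coordinates. -/
noncomputable def softMax (p : ℝ × ℝ) : ℝ := (p.1 + p.2 + softAbs (p.1 - p.2)) / 2

/-- The truncated parabola `(9/4 - m²)₊`. -/
noncomputable def cap (m : ℝ) : ℝ := max (9 / 4 - m ^ 2) 0

lemma softAbs_pos (z : ℝ) : 0 < softAbs z := Real.sqrt_pos.2 (by positivity)

lemma softAbs_sq (z : ℝ) : softAbs z ^ 2 = z ^ 2 + (1 / 200) ^ 2 :=
  Real.sq_sqrt (by positivity)

lemma abs_le_softAbs (z : ℝ) : |z| ≤ softAbs z :=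
  abs_le_of_sq_le_sq (by rw [softAbs_sq]; linarith [sq_nonneg (1 / 200 : ℝ)]) (softAbs_pos z).le

lemma softAbs_le (z : ℝ) : softAbs z ≤ |z| + 1 / 200 :=
  abs_le_of_sq_le_sq' (by rw [softAbs_sq]; nlinarith [abs_nonneg z, sq_abs z]) (by positivity) |>.2

lemma softAbs_abs (z : ℝ) : softAbs |z| = softAbs z := by simp [softAbs]

lemma softAbs_neg (z : ℝ) : softAbs (-z) = softAbs z := by simp [softAbs]

lemma contDiff_softAbs : ContDiff ℝ 1 softAbs :=
  ContDiff.sqrt (by fun_prop) fun z => by positivity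

lemma continuous_softAbs : Continuous softAbs := contDiff_softAbs.continuous

lemma hasDerivAt_softAbs (z : ℝ) : HasDerivAt softAbs (z / softAbs z) z := by
  have h : HasDerivAt (fun z : ℝ => z ^ 2 + (1 / 200) ^ 2) (2 * z) z := by
    simpa using (hasDerivAt_pow 2 z).add_const ((1 / 200 : ℝ) ^ 2)
  convert! h.sqrt (by positivity) using 1
  rw [mul_div_mul_left _ _ two_ne_zero]
  rfl

lemma contDiff_softMax : ContDiff ℝ 1 softMax := by
  have := contDiff_softAbs
  unfold softMax
  fun_prop

lemma continuous_softMax : Continuous softMax := contDiff_softMax.continuous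

lemma continuous_cap : Continuous cap := by unfold cap; fun_prop

lemma cap_nonneg (m : ℝ) : 0 ≤ cap m := le_max_right _ _

lemma cap_eq_zero {m : ℝ} (hm : 3 / 2 ≤ m) : cap m = 0 := max_eq_right (by nlinarith)

lemma cap_of_mem {m : ℝ} (h₀ : 0 ≤ m) (h₁ : m ≤ 3 / 2) : cap m = 9 / 4 - m ^ 2 :=
  max_eq_left (by nlinarith)

lemma hasDerivAt_max_zero_pow_three (t : ℝ) :
    HasDerivAt (fun t : ℝ => max t 0 ^ 3) (3 * max t 0 ^ 2) t := by
  rcases lt_trichotomy t 0 with h | rfl | h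
  · rw [max_eq_right h.le]
    refine HasDerivAt.congr_of_eventuallyEq (f := fun _ => (0 : ℝ))
      (by simpa using hasDerivAt_const t (0 : ℝ)) ?_
    filter_upwards [Iio_mem_nhds h] with s hs
    simp [max_eq_right (le_of_lt (Set.mem_Iio.1 hs))]
  · rw [hasDerivAt_iff_isLittleO]
    simp only [max_self, ne_eq, OfNat.ofNat_ne_zero, not_false_eq_true, zero_pow, mul_zero,
      smul_zero, sub_zero]
    refine Asymptotics.IsBigO.trans_isLittleO (g := fun t : ℝ => t ^ 3) ?_ ?_
    · refine Asymptotics.isBigO_of_le _ fun s => ?_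
      rw [norm_pow, norm_pow]
      gcongr
      rw [Real.norm_eq_abs, Real.norm_eq_abs, abs_of_nonneg (le_max_right _ _)]
      exact max_le (le_abs_self s) (abs_nonneg s)
    · simpa using Asymptotics.isLittleO_pow_pow (𝕜 := ℝ) (m := 1) (n := 3) (by norm_num)
  · rw [max_eq_left h.le]
    refine HasDerivAt.congr_of_eventuallyEq (f := fun s : ℝ => s ^ 3)
      (by simpa using hasDerivAt_pow 3 t) ?_
    filter_upwards [Ioi_mem_nhds h] with s hs
    simp [max_eq_left (le_of_lt (Set.mem_Ioi.1 hs))]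

lemma hasDerivAt_cap_pow_three (m : ℝ) :
    HasDerivAt (fun m => cap m ^ 3) (-6 * m * cap m ^ 2) m := by
  have h : HasDerivAt (fun m : ℝ => 9 / 4 - m ^ 2) (-(2 * m)) m := by
    simpa using (hasDerivAt_pow 2 m).const_sub (9 / 4)
  convert! (hasDerivAt_max_zero_pow_three (9 / 4 - m ^ 2)).comp m h using 1
  unfold cap
  ring

lemma contDiff_cap_pow_three : ContDiff ℝ 1 (fun m => cap m ^ 3) := by
  rw [contDiff_one_iff_deriv]
  refine ⟨fun m => (hasDerivAt_cap_pow_three m).differentiableAt, ?_⟩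
  rw [funext fun m => (hasDerivAt_cap_pow_three m).deriv]
  have := continuous_cap
  fun_prop

/-- The trial function before it is cut off away from the domain. -/
noncomputable def trial (p : ℝ × ℝ) : ℝ := (1 - (p.1 - p.2) ^ 12) * cap (softMax p) ^ 3

lemma contDiff_trial : ContDiff ℝ 1 trial := by
  have := contDiff_cap_pow_three.comp contDiff_softMax
  unfold trial
  refine ContDiff.mul (by fun_prop) this

lemma softMax_swap (x y : ℝ) : softMax (x, y) = softMax (y, x) := by
  simp only [softMax]
  rw [← softAbs_neg, neg_sub, add_comm x y]

lemma trial_swap (x y : ℝ) : trial (x, y) = trial (y, x) := by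
  simp only [trial, softMax_swap x y]
  ring

lemma le_softMax (p : ℝ × ℝ) : p.1 ≤ softMax p ∧ p.2 ≤ softMax p := by
  have h := abs_le_softAbs (p.1 - p.2)
  have h₁ := (abs_le.1 h).1
  have h₂ := (abs_le.1 h).2
  unfold softMax
  constructor <;> linarith

lemma norm_fderiv_trial_le {p : ℝ × ℝ} (hp : p ∈ pairDomain 1) :
    ‖fderiv ℝ trial p‖ ≤ (1 - |p.1 - p.2| ^ 12) * (6 * softMax p * cap (softMax p) ^ 2) +
      24 * |p.1 - p.2| ^ 11 * cap (softMax p) ^ 3 := by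
  obtain ⟨hx, hy, hz⟩ := hp
  set z := p.1 - p.2 with hzdef
  set m := softMax p with hm
  set σ := z / softAbs z with hσ
  have hm0 : 0 ≤ m := hx.trans (le_softMax p).1
  have hσ1 : |σ| ≤ 1 := by
    rw [hσ, abs_div, abs_of_pos (softAbs_pos z)]
    exact div_le_one_of_le₀ (abs_le_softAbs z) (softAbs_pos z).le
  have hsub : HasFDerivAt (fun p : ℝ × ℝ => p.1 - p.2)
      (ContinuousLinearMap.fst ℝ ℝ ℝ - ContinuousLinearMap.snd ℝ ℝ ℝ) p :=
    hasFDerivAt_fst.sub hasFDerivAt_snd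
  have hadd : HasFDerivAt (fun p : ℝ × ℝ => p.1 + p.2)
      (ContinuousLinearMap.fst ℝ ℝ ℝ + ContinuousLinearMap.snd ℝ ℝ ℝ) p :=
    hasFDerivAt_fst.add hasFDerivAt_snd
  have hs := HasDerivAt.comp_hasFDerivAt (h₂ := softAbs) (f := fun p : ℝ × ℝ => p.1 - p.2) p
    (hasDerivAt_softAbs z) hsub
  have hmd := ((hadd.add hs).const_mul (1 / 2 : ℝ)).congr_of_eventuallyEq (f₁ := softMax)
    (Filter.Eventually.of_forall fun q => by simp [softMax]; ring)
  have hcap := HasDerivAt.comp_hasFDerivAt (h₂ := fun m => cap m ^ 3) p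
    (hasDerivAt_cap_pow_three m) hmd
  have hg := HasDerivAt.comp_hasFDerivAt (h₂ := fun z : ℝ => 1 - z ^ 12)
    (f := fun p : ℝ × ℝ => p.1 - p.2) p ((hasDerivAt_pow 12 z).const_sub 1) hsub
  have htot : HasFDerivAt trial _ p := hg.mul hcap
  rw [htot.fderiv]
  have hz0 : 0 ≤ |z| := abs_nonneg z
  have hg0 : 0 ≤ 1 - |z| ^ 12 := by
    have := pow_le_one₀ (n := 12) hz0 hz
    linarith
  have hz12 : z ^ 12 = |z| ^ 12 := by rw [← abs_pow, abs_of_nonneg (by positivity)]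
  have hc := cap_nonneg m
  refine ContinuousLinearMap.opNorm_le_bound _ (by positivity) fun v => ?_
  set N := ‖v‖ with hN
  have hv1 : |v.1| ≤ N := norm_fst_le v
  have hv2 : |v.2| ≤ N := norm_snd_le v
  have hN0 : 0 ≤ N := norm_nonneg v
  have hA : |(1 + σ) / 2 * v.1 + (1 - σ) / 2 * v.2| ≤ N := by
    have h1 := (abs_le.1 hσ1).1
    have h2 := (abs_le.1 hσ1).2
    calc _ ≤ |(1 + σ) / 2 * v.1| + |(1 - σ) / 2 * v.2| := abs_add_le _ _
      _ = (1 + σ) / 2 * |v.1| + (1 - σ) / 2 * |v.2| := by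
        rw [abs_mul, abs_mul, abs_of_nonneg (by linarith : 0 ≤ (1 + σ) / 2),
          abs_of_nonneg (by linarith : 0 ≤ (1 - σ) / 2)]
      _ ≤ (1 + σ) / 2 * N + (1 - σ) / 2 * N := by gcongr <;> linarith
      _ = N := by ring
  have hB : |v.1 - v.2| ≤ 2 * N := (abs_sub _ _).trans (by linarith)
  calc _ = ‖(1 - |z| ^ 12) * (6 * m * cap m ^ 2) * -((1 + σ) / 2 * v.1 + (1 - σ) / 2 * v.2)
          + 12 * z ^ 11 * cap m ^ 3 * -(v.1 - v.2)‖ := by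
        congr 1
        rw [← hz12]
        simp [← hzdef, ← hm, ← hσ]
        ring
    _ ≤ (1 - |z| ^ 12) * (6 * m * cap m ^ 2) * |(1 + σ) / 2 * v.1 + (1 - σ) / 2 * v.2|
          + 12 * |z| ^ 11 * cap m ^ 3 * |v.1 - v.2| := by
        refine (norm_add_le _ _).trans (le_of_eq ?_)
        simp only [Real.norm_eq_abs]
        rw [abs_mul, abs_neg,
          abs_of_nonneg (by positivity : 0 ≤ (1 - |z| ^ 12) * (6 * m * cap m ^ 2)), abs_mul,
          abs_neg, abs_mul, abs_mul, abs_pow, abs_of_nonneg (pow_nonneg hc 3),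
          abs_of_pos (by norm_num : (0:ℝ) < 12)]
    _ ≤ (1 - |z| ^ 12) * (6 * m * cap m ^ 2) * N + 12 * |z| ^ 11 * cap m ^ 3 * (2 * N) := by
        gcongr
    _ = _ := by ring

/-- The lower boundary `(z + √(z² + δ²)) / 2` of the domain in the coordinates
`(z, m) = (x - y, softMax (x, y))`. -/
noncomputable def lowerEdge (z : ℝ) : ℝ := (z + softAbs z) / 2

lemma continuous_lowerEdge : Continuous lowerEdge := by
  have := continuous_softAbs
  unfold lowerEdge
  fun_prop

lemma le_lowerEdge (z : ℝ) : z ≤ lowerEdge z := by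
  have := (le_abs_self z).trans (abs_le_softAbs z)
  unfold lowerEdge; linarith

lemma lowerEdge_le {z : ℝ} (hz : 0 ≤ z) : lowerEdge z ≤ z + 1 / 400 := by
  have := softAbs_le z
  rw [abs_of_nonneg hz] at this
  unfold lowerEdge; linarith

/-- The coordinate change `(z, m) ↦ (x, y)` inverse to `z = x - y`, `m = softMax (x, y)`. -/
noncomputable def softMaxCoord : ℝ × ℝ ≃ₜ ℝ × ℝ where
  toFun q := (q.2 + (q.1 - softAbs q.1) / 2, q.2 - (q.1 + softAbs q.1) / 2)
  invFun p := (p.1 - p.2, softMax p)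
  left_inv q := by
    have h : q.2 + (q.1 - softAbs q.1) / 2 - (q.2 - (q.1 + softAbs q.1) / 2) = q.1 := by ring
    ext
    · exact h
    · simp only [softMax, h]; ring
  right_inv p := by
    ext <;> simp only [softMax] <;> ring
  continuous_toFun := by
    have := continuous_softAbs
    fun_prop
  continuous_invFun := by
    have := continuous_softMax
    fun_prop

lemma softMaxCoord_fst_sub_snd (q : ℝ × ℝ) :
    (softMaxCoord q).1 - (softMaxCoord q).2 = q.1 :=
  congrArg Prod.fst (softMaxCoord.symm_apply_apply q)

lemma softMax_softMaxCoord (q : ℝ × ℝ) : softMax (softMaxCoord q) = q.2 :=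
  congrArg Prod.snd (softMaxCoord.symm_apply_apply q)

lemma measurePreserving_softMaxCoord : MeasurePreserving softMaxCoord := by
  have h₁ : MeasurePreserving (fun q : ℝ × ℝ => (q.1, q.2 - (q.1 + softAbs q.1) / 2))
      (volume.prod volume) (volume.prod volume) := by
    have := continuous_softAbs
    refine MeasurePreserving.skew_product (g := fun z m => m - (z + softAbs z) / 2)
      (MeasurePreserving.id volume) (by fun_prop) (Filter.Eventually.of_forall fun z => ?_)
    exact (measurePreserving_sub_right volume _).map_eq
  have h₂ := (measurePreserving_add_prod (volume : Measure ℝ) (volume : Measure ℝ)).comp h₁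
  convert! h₂ using 1
  ext q <;> simp [softMaxCoord]
  ring

lemma softMaxCoord_mem_pairDomain (q : ℝ × ℝ) :
    softMaxCoord q ∈ pairDomain 1 ↔ |q.1| ≤ 1 ∧ lowerEdge |q.1| ≤ q.2 := by
  have h := softMaxCoord_fst_sub_snd q
  simp only [pairDomain, mem_ofPred_eq, h, lowerEdge, softAbs_abs]
  simp only [softMaxCoord, Homeomorph.homeomorph_mk_coe, Equiv.coe_fn_mk]
  rcases abs_cases q.1 with ⟨h₁, h₂⟩ | ⟨h₁, h₂⟩ <;> rw [h₁]
  · exact ⟨fun ⟨_, h, h'⟩ => ⟨h', by linarith⟩,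
      fun ⟨h, h'⟩ => ⟨by linarith, by linarith, h⟩⟩
  · exact ⟨fun ⟨h, _, h'⟩ => ⟨h', by linarith⟩,
      fun ⟨h, h'⟩ => ⟨by linarith, by linarith, h⟩⟩

/-- Integration over the domain in the coordinates `(|x - y|, softMax (x, y))`. -/
lemma setIntegral_pairDomain {w : ℝ → ℝ → ℝ} (hw : Continuous (Function.uncurry w))
    (hw₀ : ∀ z m, 3 / 2 ≤ m → w z m = 0) :
    IntegrableOn (fun p : ℝ × ℝ => w |p.1 - p.2| (softMax p)) (pairDomain 1) ∧
    ∫ p in pairDomain 1, w |p.1 - p.2| (softMax p) =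
      2 * ∫ z in (0 : ℝ)..1, ∫ m in lowerEdge z..(3 / 2), w z m := by
  have hlc := continuous_lowerEdge
  have hemb := softMaxCoord.measurableEmbedding
  set S : Set (ℝ × ℝ) := {q | |q.1| ≤ 1 ∧ lowerEdge |q.1| ≤ q.2} with hS
  set F : ℝ × ℝ → ℝ := fun q => w |q.1| q.2 with hF
  have hFc : Continuous F := hw.comp (by fun_prop : Continuous fun q : ℝ × ℝ => (|q.1|, q.2))
  have hpre : softMaxCoord ⁻¹' pairDomain 1 = S := by
    ext q; exact softMaxCoord_mem_pairDomain q
  have hcomp : (fun p : ℝ × ℝ => w |p.1 - p.2| (softMax p)) ∘ softMaxCoord = F := by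
    funext q
    simp only [Function.comp, softMaxCoord_fst_sub_snd, softMax_softMaxCoord, hF]
  have hSm : MeasurableSet S :=
    ((isClosed_le (f := fun q : ℝ × ℝ => |q.1|) (g := fun _ => 1) (by fun_prop)
      (by fun_prop)).inter (isClosed_le (f := fun q : ℝ × ℝ => lowerEdge |q.1|)
      (g := fun q => q.2) (by fun_prop) (by fun_prop))).measurableSet
  have hle : ∀ z : ℝ, |z| ≤ 1 → lowerEdge |z| ≤ 3 / 2 := fun z hz => by
    linarith [lowerEdge_le (abs_nonneg z)]
  have hind : S.indicator F = (S ∩ Icc (-1) 1 ×ˢ Icc 0 (3 / 2)).indicator F := by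
    funext q
    by_cases hq : q ∈ S
    · by_cases hm : q.2 ≤ 3 / 2
      · rw [indicator_of_mem hq, indicator_of_mem]
        exact ⟨hq, abs_le.1 hq.1, ((abs_nonneg _).trans (le_lowerEdge _)).trans hq.2, hm⟩
      · rw [indicator_of_mem hq, indicator_of_notMem fun h => hm h.2.2.2]
        exact hw₀ _ _ (not_le.1 hm).le
    · rw [indicator_of_notMem hq, indicator_of_notMem fun h => hq h.1]
  have hint : Integrable (S.indicator F) := by
    rw [hind, integrable_indicator_iff
      (hSm.inter (measurableSet_Icc.prod measurableSet_Icc))]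
    exact (hFc.continuousOn.integrableOn_compact (isCompact_Icc.prod isCompact_Icc)).mono_set
      inter_subset_right
  constructor
  · rw [← measurePreserving_softMaxCoord.integrableOn_comp_preimage hemb, hpre, hcomp]
    exact (integrable_indicator_iff hSm).1 hint
  · rw [← measurePreserving_softMaxCoord.setIntegral_preimage_emb hemb, hpre]
    change ∫ q in S, ((fun p : ℝ × ℝ => w |p.1 - p.2| (softMax p)) ∘ softMaxCoord) q = _
    rw [hcomp, ← integral_indicator hSm, Measure.volume_eq_prod, integral_prod _ hint]
    have hinner : ∀ z : ℝ, ∫ m, S.indicator F (z, m) =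
        (Iic 1).indicator (fun z => ∫ m in lowerEdge z..(3 / 2), w z m) |z| := by
      intro z
      by_cases hz : |z| ≤ 1
      · rw [indicator_of_mem (show |z| ∈ Iic 1 from hz),
          intervalIntegral.integral_of_le (hle z hz), ← integral_Icc_eq_integral_Ioc,
          ← integral_indicator measurableSet_Icc]
        congr 1
        funext m
        by_cases hm : m ∈ Icc (lowerEdge |z|) (3 / 2)
        · rw [indicator_of_mem hm, indicator_of_mem (show (z, m) ∈ S from ⟨hz, hm.1⟩)]
        · rw [indicator_of_notMem hm]
          by_cases hm' : (z, m) ∈ S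
          · rw [indicator_of_mem hm']
            exact hw₀ _ _ (not_le.1 fun h => hm ⟨hm'.2, h⟩).le
          · rw [indicator_of_notMem hm']
      · rw [indicator_of_notMem (show |z| ∉ Iic 1 from hz)]
        refine integral_eq_zero_of_ae (Filter.Eventually.of_forall fun m => ?_)
        exact indicator_of_notMem (fun h => hz h.1) _
    simp_rw [hinner]
    rw [integral_comp_abs (f := (Iic 1).indicator fun z => ∫ m in lowerEdge z..(3 / 2), w z m),
      setIntegral_indicator measurableSet_Iic, Ioi_inter_Iic,
      intervalIntegral.integral_of_le zero_le_one]

lemma integral_sum_monomials (l : List (ℝ × ℕ)) :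
    ∫ z in (0 : ℝ)..1, (l.map fun c => c.1 * z ^ c.2).sum =
      (l.map fun c => c.1 / ((c.2 : ℝ) + 1)).sum := by
  induction l with
  | nil => simp
  | cons c l ih =>
    simp only [List.map_cons, List.sum_cons]
    rw [intervalIntegral.integral_add ((by fun_prop : Continuous _).intervalIntegrable _ _), ih]
    · simp [div_eq_mul_inv]
    · refine Continuous.intervalIntegrable ?_ _ _
      exact continuous_list_sum _ fun c _ => by fun_prop

lemma hasDerivAt_monomial (c : ℝ) (n : ℕ) (m : ℝ) :
    HasDerivAt (fun m => c * m ^ (n + 1)) (c * ((n + 1) * m ^ n)) m := by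
  simpa using (hasDerivAt_pow (n + 1) m).const_mul c

/-- An antiderivative of `m ↦ (9/4 - m²)⁶`. -/
noncomputable def massPrimitive (m : ℝ) : ℝ :=
  531441 / 4096 * m ^ 1 + -59049 / 512 * m ^ 3 + 19683 / 256 * m ^ 5 + -3645 / 112 * m ^ 7 +
    135 / 16 * m ^ 9 + -27 / 22 * m ^ 11 + 1 / 13 * m ^ 13

lemma hasDerivAt_massPrimitive (m : ℝ) :
    HasDerivAt massPrimitive ((9 / 4 - m ^ 2) ^ 6) m := by
  have h := ((((((hasDerivAt_monomial (531441 / 4096) 0 m).add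
    (hasDerivAt_monomial (-59049 / 512) 2 m)).add (hasDerivAt_monomial (19683 / 256) 4 m)).add
    (hasDerivAt_monomial (-3645 / 112) 6 m)).add (hasDerivAt_monomial (135 / 16) 8 m)).add
    (hasDerivAt_monomial (-27 / 22) 10 m)).add (hasDerivAt_monomial (1 / 13) 12 m)
  convert! h using 1
  push_cast
  ring

/-- An antiderivative of `m ↦ 36 m² (9/4 - m²)⁴`. -/
noncomputable def slopePrimitive (m : ℝ) : ℝ :=
  19683 / 64 * m ^ 3 + -6561 / 20 * m ^ 5 + 2187 / 14 * m ^ 7 + -36 * m ^ 9 + 36 / 11 * m ^ 11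

lemma hasDerivAt_slopePrimitive (m : ℝ) :
    HasDerivAt slopePrimitive (36 * m ^ 2 * (9 / 4 - m ^ 2) ^ 4) m := by
  have h := ((((hasDerivAt_monomial (19683 / 64) 2 m).add
    (hasDerivAt_monomial (-6561 / 20) 4 m)).add (hasDerivAt_monomial (2187 / 14) 6 m)).add
    (hasDerivAt_monomial (-36) 8 m)).add (hasDerivAt_monomial (36 / 11) 10 m)
  convert! h using 1
  push_cast
  ring

/-- The mass density `trial²` in the coordinates `(|x - y|, softMax (x, y))`. -/
noncomputable def massDensity (z m : ℝ) : ℝ := (1 - z ^ 12) ^ 2 * cap m ^ 6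

/-- An upper bound for the energy density of `trial` in the coordinates
`(|x - y|, softMax (x, y))`. -/
noncomputable def energyDensity (z m : ℝ) : ℝ :=
  ((1 - z ^ 12) * (6 * m * cap m ^ 2) + 24 * z ^ 11 * cap m ^ 3) ^ 2

lemma continuous_massDensity : Continuous (Function.uncurry massDensity) := by
  have := continuous_cap
  unfold massDensity Function.uncurry
  fun_prop

lemma continuous_energyDensity : Continuous (Function.uncurry energyDensity) := by
  have := continuous_cap
  unfold energyDensity Function.uncurry
  fun_prop

lemma continuous_massDensity_right (z : ℝ) : Continuous (massDensity z) := by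
  have := continuous_cap
  unfold massDensity
  fun_prop

lemma continuous_energyDensity_right (z : ℝ) : Continuous (energyDensity z) := by
  have := continuous_cap
  unfold energyDensity
  fun_prop

lemma integral_massDensity {z : ℝ} (h₀ : 0 ≤ z) (h₁ : z ≤ 1) :
    ∫ m in z..(3 / 2), massDensity z m =
      (1 - z ^ 12) ^ 2 * (massPrimitive (3 / 2) - massPrimitive z) := by
  rw [mul_sub, ← intervalIntegral.integral_eq_sub_of_hasDerivAt
    (fun m _ => (hasDerivAt_massPrimitive m).const_mul ((1 - z ^ 12) ^ 2))
    ((by fun_prop : Continuous _).intervalIntegrable _ _)]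
  refine intervalIntegral.integral_congr fun m hm => ?_
  rw [uIcc_of_le (by linarith)] at hm
  simp only [massDensity, cap_of_mem (h₀.trans hm.1) hm.2]

lemma integral_energyDensity {z : ℝ} (h₀ : 0 ≤ z) (h₁ : z ≤ 1) :
    ∫ m in z..(3 / 2), energyDensity z m =
      (1 - z ^ 12) ^ 2 * (slopePrimitive (3 / 2) - slopePrimitive z) +
      24 * (1 - z ^ 12) * z ^ 11 * (9 / 4 - z ^ 2) ^ 6 +
      576 * z ^ 22 * (massPrimitive (3 / 2) - massPrimitive z) := by
  have hd : ∀ m : ℝ, HasDerivAt (fun m => (1 - z ^ 12) ^ 2 * slopePrimitive m +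
      -24 * (1 - z ^ 12) * z ^ 11 * (9 / 4 - m ^ 2) ^ 6 + 576 * z ^ 22 * massPrimitive m)
      (((1 - z ^ 12) * (6 * m * (9 / 4 - m ^ 2) ^ 2) + 24 * z ^ 11 * (9 / 4 - m ^ 2) ^ 3) ^ 2)
      m := by
    intro m
    have hq : HasDerivAt (fun m : ℝ => 9 / 4 - m ^ 2) (-(2 * m)) m := by
      simpa using (hasDerivAt_pow 2 m).const_sub (9 / 4)
    convert! (((hasDerivAt_slopePrimitive m).const_mul ((1 - z ^ 12) ^ 2)).add
      ((hq.pow 6).const_mul (-24 * (1 - z ^ 12) * z ^ 11))).add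
      ((hasDerivAt_massPrimitive m).const_mul (576 * z ^ 22)) using 1
    push_cast
    ring
  have h := intervalIntegral.integral_eq_sub_of_hasDerivAt (a := z) (b := 3 / 2)
    (fun m _ => hd m) ((by fun_prop : Continuous _).intervalIntegrable _ _)
  calc _ = _ := intervalIntegral.integral_congr fun m hm => ?_
    _ = _ := h
    _ = _ := by ring
  rw [uIcc_of_le (by linarith)] at hm
  simp only [energyDensity, cap_of_mem (h₀.trans hm.1) hm.2]

lemma integral_integral_massDensity :
    ∫ z in (0 : ℝ)..1, ((1 - z ^ 12) ^ 2 * (massPrimitive (3 / 2) - massPrimitive z)) =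
      810706163343 / 39127961600 := by
  have h := integral_sum_monomials
    [(531441 / 8008, 0), (-531441 / 4096, 1), (59049 / 512, 3), (-19683 / 256, 5),
      (3645 / 112, 7), (-135 / 16, 9), (27 / 22, 11), (-531441 / 4004, 12), (6906685 /
      26624, 13), (-59049 / 256, 15), (19683 / 128, 17), (-3645 / 56, 19), (135 / 8,
      21), (-27 / 11, 23), (531441 / 8008, 24), (-6900541 / 53248, 25), (59049 / 512,
      27), (-19683 / 256, 29), (3645 / 112, 31), (-135 / 16, 33), (27 / 22, 35), (-1 /
      13, 37)]
  calc _ = _ := intervalIntegral.integral_congr fun z _ => ?_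
    _ = _ := h
    _ = _ := by norm_num
  simp only [massPrimitive, List.map_cons, List.map_nil, List.sum_cons, List.sum_nil]
  ring

lemma integral_integral_energyDensity :
    ∫ z in (0 : ℝ)..1, ((1 - z ^ 12) ^ 2 * (slopePrimitive (3 / 2) - slopePrimitive z) +
      24 * (1 - z ^ 12) * z ^ 11 * (9 / 4 - z ^ 2) ^ 6 +
      576 * z ^ 22 * (massPrimitive (3 / 2) - massPrimitive z)) =
      59552570372257 / 601176576000 := by
  have h := integral_sum_monomials
    [(177147 / 1540, 0), (-19683 / 64, 3), (6561 / 20, 5), (-2187 / 14, 7), (36, 9),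
      (17519121 / 5632, 11), (-177147 / 770, 12), (-531441 / 64, 13), (19683 / 2, 15),
      (-30618 / 5, 17), (29889 / 14, 19), (-396, 21), (38263752 / 1001, 22), (-438266793
      / 5632, 23), (177147 / 1540, 24), (4782969 / 64, 25), (-3444525 / 64, 27),
      (3435777 / 140, 29), (-47871 / 7, 31), (11736 / 11, 33), (-10236 / 143, 35)]
  calc _ = _ := intervalIntegral.integral_congr fun z _ => ?_
    _ = _ := h
    _ = _ := by norm_num
  simp only [massPrimitive, slopePrimitive, List.map_cons, List.map_nil, List.sum_cons,
    List.sum_nil]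
  ring

lemma continuous_integral_lowerEdge {w : ℝ → ℝ → ℝ} (hw : Continuous (Function.uncurry w)) :
    Continuous fun z => ∫ m in lowerEdge z..(3 / 2), w z m := by
  simp_rw [fun z => intervalIntegral.integral_symm (μ := volume) (f := w z) (3 / 2) (lowerEdge z)]
  exact (intervalIntegral.continuous_parametric_intervalIntegral_of_continuous hw
    continuous_lowerEdge).neg

lemma continuous_massPrimitive : Continuous massPrimitive := by
  unfold massPrimitive; fun_prop

lemma continuous_slopePrimitive : Continuous slopePrimitive := by
  unfold slopePrimitive; fun_prop

lemma setIntegral_energy_le :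
    ∫ p in pairDomain 1, ‖fderiv ℝ trial p‖ ^ 2 ≤ 2 * (59552570372257 / 601176576000) := by
  have hmeas : MeasurableSet (pairDomain 1) :=
    ((isClosed_le (f := fun _ : ℝ × ℝ => (0 : ℝ)) (g := Prod.fst) (by fun_prop)
      (by fun_prop)).inter ((isClosed_le (f := fun _ : ℝ × ℝ => (0 : ℝ)) (g := Prod.snd)
      (by fun_prop) (by fun_prop)).inter (isClosed_le (f := fun p : ℝ × ℝ => |p.1 - p.2|)
      (g := fun _ => 1) (by fun_prop) (by fun_prop)))).measurableSet
  obtain ⟨hint, heq⟩ := setIntegral_pairDomain continuous_energyDensity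
    fun z m hm => by simp [energyDensity, cap_eq_zero hm]
  refine (integral_mono_of_nonneg (Filter.Eventually.of_forall fun p => by positivity) hint
    ((ae_restrict_iff' hmeas).2 (Filter.Eventually.of_forall fun p hp => ?_))).trans ?_
  · exact pow_le_pow_left₀ (norm_nonneg _) (norm_fderiv_trial_le hp) 2
  · rw [heq, ← integral_integral_energyDensity]
    have := continuous_massPrimitive
    have := continuous_slopePrimitive
    refine mul_le_mul_of_nonneg_left (intervalIntegral.integral_mono_on zero_le_one
      ((continuous_integral_lowerEdge continuous_energyDensity).intervalIntegrable _ _)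
      ((by fun_prop : Continuous _).intervalIntegrable _ _) fun z hz => ?_) zero_le_two
    refine le_trans ?_ (integral_energyDensity hz.1 hz.2).le
    have hc : Continuous (energyDensity z) := continuous_energyDensity_right z
    refine intervalIntegral.integral_mono_interval (le_lowerEdge z)
      (by linarith [lowerEdge_le hz.1, hz.2]) le_rfl
      (Filter.Eventually.of_forall fun m => sq_nonneg _) (hc.intervalIntegrable _ _)

lemma le_setIntegral_trial_sq :
    2 * (810706163343 / 39127961600 - 1 / 400 * (9 / 4) ^ 6) ≤
      ∫ p in pairDomain 1, trial p ^ 2 := by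
  obtain ⟨-, heq⟩ := setIntegral_pairDomain continuous_massDensity
    fun z m hm => by simp [massDensity, cap_eq_zero hm]
  have htrial : ∀ p : ℝ × ℝ, trial p ^ 2 = massDensity |p.1 - p.2| (softMax p) := fun p => by
    have : |p.1 - p.2| ^ 12 = (p.1 - p.2) ^ 12 := Even.pow_abs (by decide) _
    rw [massDensity, this, trial]
    ring
  simp_rw [htrial]
  rw [heq, ← integral_integral_massDensity]
  have := continuous_massPrimitive
  have hsub : (∫ z in (0 : ℝ)..1, ((1 - z ^ 12) ^ 2 * (massPrimitive (3 / 2) - massPrimitive z)))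
      - 1 / 400 * (9 / 4) ^ 6 = ∫ z in (0 : ℝ)..1,
        ((1 - z ^ 12) ^ 2 * (massPrimitive (3 / 2) - massPrimitive z) - 1 / 400 * (9 / 4) ^ 6) := by
    rw [intervalIntegral.integral_sub ((by fun_prop : Continuous _).intervalIntegrable _ _)
      (by simp)]
    simp
  rw [hsub]
  refine mul_le_mul_of_nonneg_left (intervalIntegral.integral_mono_on zero_le_one
    ((by fun_prop : Continuous _).intervalIntegrable _ _)
    ((continuous_integral_lowerEdge continuous_massDensity).intervalIntegrable _ _)
    fun z hz => ?_) zero_le_two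
  refine (sub_le_sub_right (integral_massDensity hz.1 hz.2).ge _).trans ?_
  have hc : Continuous (massDensity z) := continuous_massDensity_right z
  rw [← intervalIntegral.integral_add_adjacent_intervals (b := lowerEdge z)
    (hc.intervalIntegrable _ _) (hc.intervalIntegrable _ _)]
  have hle : ∫ m in z..lowerEdge z, massDensity z m ≤ ∫ m in z..lowerEdge z, (9 / 4 : ℝ) ^ 6 := by
    refine intervalIntegral.integral_mono_on (le_lowerEdge z) (hc.intervalIntegrable _ _)
      (by simp) fun m _ => ?_
    have hz12 := pow_le_one₀ (n := 12) hz.1 hz.2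
    have hz0 := pow_nonneg hz.1 12
    have hcap : cap m ≤ 9 / 4 := max_le (by nlinarith [sq_nonneg m]) (by norm_num)
    calc massDensity z m ≤ 1 * (9 / 4) ^ 6 :=
          mul_le_mul (pow_le_one₀ (by linarith) (by linarith))
            (pow_le_pow_left₀ (cap_nonneg m) hcap 6) (pow_nonneg (cap_nonneg m) 6) zero_le_one
      _ = _ := one_mul _
  rw [intervalIntegral.integral_const, smul_eq_mul] at hle
  have : (lowerEdge z - z) * (9 / 4 : ℝ) ^ 6 ≤ 1 / 400 * (9 / 4) ^ 6 := by
    gcongr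
    linarith [lowerEdge_le hz.1]
  linarith

/-- A trial function on the domain of width `1` whose energy is below the threshold `π² / 2`. -/
lemma exists_isTestFunction_one :
    ∃ φ : ℝ × ℝ → ℝ, IsTestFunction 1 φ ∧ 0 < ∫ p in pairDomain 1, φ p ^ 2 ∧
      ∫ p in pairDomain 1, ‖fderiv ℝ φ p‖ ^ 2 < π ^ 2 / 2 * ∫ p in pairDomain 1, φ p ^ 2 := by
  let χ : ContDiffBump (0 : ℝ) := ⟨3, 4, by norm_num, by norm_num⟩
  let φ : ℝ × ℝ → ℝ := fun p => χ p.1 * χ p.2 * trial p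
  have hclosed : IsClosed (pairDomain 1) :=
    (isClosed_le (by fun_prop : Continuous fun _ : ℝ × ℝ => (0 : ℝ)) continuous_fst).inter
      ((isClosed_le (by fun_prop : Continuous fun _ : ℝ × ℝ => (0 : ℝ)) continuous_snd).inter
      (isClosed_le (by fun_prop : Continuous fun p : ℝ × ℝ => |p.1 - p.2|) continuous_const))
  have heq : ∀ p ∈ pairDomain 1, φ =ᶠ[nhds p] trial := by
    rintro p ⟨hx, hy, -⟩
    by_cases hp : p.1 < 3 ∧ p.2 < 3
    · have hnhds : Ioo (-3) 3 ×ˢ Ioo (-3) 3 ∈ nhds p :=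
        prod_mem_nhds (Ioo_mem_nhds (by linarith) hp.1) (Ioo_mem_nhds (by linarith) hp.2)
      filter_upwards [hnhds] with q hq
      have h : ∀ t ∈ Ioo (-3 : ℝ) 3, χ t = 1 := fun t ht =>
        χ.one_of_mem_closedBall (by
          rw [mem_closedBall_zero_iff, Real.norm_eq_abs]
          exact abs_le.2 ⟨ht.1.le, ht.2.le⟩)
      simp only [φ, h _ hq.1, h _ hq.2, one_mul]
    · have hm : 3 / 2 < softMax p := by
        have h := le_softMax p
        rcases not_and_or.1 hp with h' | h' <;> linarith [h.1, h.2]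
      filter_upwards [continuous_softMax.continuousAt.eventually (lt_mem_nhds hm)] with q hq
      simp [φ, trial, cap_eq_zero hq.le]
  have hsq : ∫ p in pairDomain 1, φ p ^ 2 = ∫ p in pairDomain 1, trial p ^ 2 :=
    setIntegral_congr_fun hclosed.measurableSet fun p hp => by
      simp only [(heq p hp).eq_of_nhds]
  have hfd : ∫ p in pairDomain 1, ‖fderiv ℝ φ p‖ ^ 2 =
      ∫ p in pairDomain 1, ‖fderiv ℝ trial p‖ ^ 2 :=
    setIntegral_congr_fun hclosed.measurableSet fun p hp => by
      simp only [(heq p hp).fderiv_eq]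
  have hmass := le_setIntegral_trial_sq
  have henergy := setIntegral_energy_le
  refine ⟨φ, ⟨?_, ?_, ?_, ?_⟩, ?_, ?_⟩
  · have hχ : ContDiff ℝ 1 χ := χ.contDiff
    exact ((hχ.comp contDiff_fst).mul (hχ.comp contDiff_snd)).mul contDiff_trial
  · refine HasCompactSupport.intro
      ((isCompact_closedBall (0 : ℝ) 4).prod (isCompact_closedBall (0 : ℝ) 4)) fun p hp => ?_
    have h : ∀ t ∉ Metric.closedBall (0 : ℝ) 4, χ t = 0 := fun t ht =>
      χ.zero_of_le_dist (not_le.1 ht).le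
    rcases not_and_or.1 (fun h => hp (mem_prod.2 h)) with h' | h' <;> simp [φ, h _ h']
  · intro x y
    simp only [φ, trial_swap x y, mul_comm (χ x)]
  · intro p _ _ hp
    have : (p.1 - p.2) ^ 12 = 1 := by
      rw [← Even.pow_abs (by decide : Even 12), hp, one_pow]
    simp [φ, trial, this]
  · rw [hsq]
    refine lt_of_lt_of_le ?_ hmass
    norm_num
  · rw [hsq, hfd]
    have hπ : (3.1415 : ℝ) ^ 2 / 2 ≤ π ^ 2 / 2 := by
      gcongr
      linarith [Real.pi_gt_d4]
    refine henergy.trans_lt (lt_of_lt_of_le ?_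
      (mul_le_mul hπ hmass (by norm_num) (by positivity)))
    norm_num

lemma mem_pairDomain_iff {d : ℝ} (hd : 0 < d) (p : ℝ × ℝ) :
    d⁻¹ • p ∈ pairDomain 1 ↔ p ∈ pairDomain d := by
  simp only [pairDomain, mem_ofPred_eq, Prod.smul_fst, Prod.smul_snd, smul_eq_mul, ← mul_sub,
    abs_mul, abs_of_pos (inv_pos.2 hd), inv_mul_le_iff₀ hd, mul_one,
    mul_nonneg_iff_of_pos_left (inv_pos.2 hd)]

open scoped Pointwise in
lemma setIntegral_pairDomain_comp_smul {d : ℝ} (hd : 0 < d) (f : ℝ × ℝ → ℝ) :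
    ∫ p in pairDomain d, f (d⁻¹ • p) = d ^ 2 * ∫ p in pairDomain 1, f p := by
  have hset : d⁻¹ • pairDomain d = pairDomain 1 := by
    ext p
    rw [mem_smul_set_iff_inv_smul_mem₀ (inv_ne_zero hd.ne'), ← mem_pairDomain_iff hd,
      smul_smul, mul_inv_cancel₀ (inv_ne_zero hd.ne'), one_smul]
  rw [Measure.setIntegral_comp_smul volume f (pairDomain d) (inv_ne_zero hd.ne'), hset]
  simp [abs_of_pos hd]

/-- A trial function on the domain of width `d` whose energy is below `π² / (2 d²)`. -/
lemma exists_isTestFunction {d : ℝ} (hd : 0 < d) :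
    ∃ φ : ℝ × ℝ → ℝ, IsTestFunction d φ ∧ 0 < ∫ p in pairDomain d, φ p ^ 2 ∧
      ∫ p in pairDomain d, ‖fderiv ℝ φ p‖ ^ 2 <
        π ^ 2 / (2 * d ^ 2) * ∫ p in pairDomain d, φ p ^ 2 := by
  obtain ⟨φ, ⟨hC, hsupp, hsymm, hzero⟩, hpos, hlt⟩ := exists_isTestFunction_one
  have hd' : d⁻¹ ≠ 0 := inv_ne_zero hd.ne'
  refine ⟨fun p => φ (d⁻¹ • p), ⟨?_, ?_, ?_, ?_⟩, ?_, ?_⟩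
  · exact hC.comp (contDiff_const_smul _)
  · exact hsupp.comp_smul hd'
  · intro x y
    exact hsymm _ _
  · intro p hx hy hp
    refine hzero _ (mul_nonneg (inv_nonneg.2 hd.le) hx) (mul_nonneg (inv_nonneg.2 hd.le) hy) ?_
    simp only [Prod.smul_fst, Prod.smul_snd, smul_eq_mul]
    rw [← mul_sub, abs_mul, hp, abs_of_pos (inv_pos.2 hd), inv_mul_cancel₀ hd.ne']
  · rw [setIntegral_pairDomain_comp_smul hd fun p => φ p ^ 2]
    positivity
  · have h : ∀ p, ‖fderiv ℝ (fun p => φ (d⁻¹ • p)) p‖ ^ 2 =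
        (d⁻¹) ^ 2 * ‖fderiv ℝ φ (d⁻¹ • p)‖ ^ 2 := fun p => by
      rw [fderiv_comp_smul, norm_smul, mul_pow, Real.norm_eq_abs, sq_abs]
    simp_rw [h]
    rw [integral_const_mul, setIntegral_pairDomain_comp_smul hd fun p => φ p ^ 2,
      setIntegral_pairDomain_comp_smul hd fun p => ‖fderiv ℝ φ p‖ ^ 2]
    convert! hlt using 1 <;> field_simp

/-- there is `α₁ > 0` such that for every `0 ≤ α < α₁` some nonzero test
function satisfies `q_α[φ] < k_D(α)² ∫_Ω |φ|²`, where `k_D(α)` is the unique root in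
`[π/(2L), π/L)` of `α sin(kL) + 2√2 k cos(kL) = 0`: the discrete spectrum of `H_α` is
non-empty for all sufficiently small `α`. -/
theorem discrete_spectrum_nonempty_small_alpha
    (d : ℝ) (hd : 0 < d) (L : ℝ) (hL : L = d / Real.sqrt 2)
    (kD : ℝ → ℝ)
    (hkD : ∀ α : ℝ, 0 ≤ α → kD α ∈ Set.Ico (π / (2 * L)) (π / L) ∧
      α * Real.sin (kD α * L) + 2 * Real.sqrt 2 * kD α * Real.cos (kD α * L) = 0) :
    ∃ α₁ : ℝ, 0 < α₁ ∧
      ∀ α : ℝ, 0 ≤ α → α < α₁ →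
        ∃ φ : ℝ × ℝ → ℝ, IsTestFunction d φ ∧
          0 < ∫ p in pairDomain d, (φ p) ^ 2 ∧
          (∫ p in pairDomain d, ‖fderiv ℝ φ p‖ ^ 2) +
              α * ∫ x in Set.Ici (0:ℝ), (φ (x, x)) ^ 2 <
            (kD α) ^ 2 * ∫ p in pairDomain d, (φ p) ^ 2 := by
  obtain ⟨φ, hφ, hpos, hlt⟩ := exists_isTestFunction hd
  set E := ∫ p in pairDomain d, ‖fderiv ℝ φ p‖ ^ 2
  set B := ∫ p in pairDomain d, φ p ^ 2
  set T := ∫ x in Ici (0 : ℝ), φ (x, x) ^ 2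
  have hT : 0 ≤ T := integral_nonneg fun x => sq_nonneg _
  have hgap : 0 < π ^ 2 / (2 * d ^ 2) * B - E := sub_pos.2 hlt
  refine ⟨(π ^ 2 / (2 * d ^ 2) * B - E) / (T + 1), by positivity, fun α hα hα' =>
    ⟨φ, hφ, hpos, ?_⟩⟩
  have hαT : α * T < π ^ 2 / (2 * d ^ 2) * B - E := by
    rw [lt_div_iff₀ (by positivity)] at hα'
    linarith
  have hLsq : (π / (2 * L)) ^ 2 = π ^ 2 / (2 * d ^ 2) := by
    rw [hL, div_pow, mul_pow, div_pow, Real.sq_sqrt zero_le_two]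
    ring
  have hLpos : 0 < L := hL ▸ div_pos hd (Real.sqrt_pos.2 zero_lt_two)
  have hk : π ^ 2 / (2 * d ^ 2) ≤ kD α ^ 2 := by
    rw [← hLsq]
    exact pow_le_pow_left₀ (by positivity) (hkD α hα).1.1 2
  have := mul_le_mul_of_nonneg_right hk hpos.le
  linarith
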